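/- Let Q[f] = Σ_{j=1}^ℓ a_j f(x_j) be a quadrature formula with nodes in [-1,1] and real weights such that Q[p] = ∫_{-1}^1 p(x) dx for every polynomial p of degree at most m, for some m ∈ ℕ₀. Fix s ∈ {0,1,...,m}. Then there is a constant C depending only on Q and s with the following property: for every interval [a,b] ⊆ ℝ of length h = b - a > 0 and every function g : [a,b] → ℝ such that g^{(s-1)} is absolutely continuous on [a,b] and g^{(s)} has finite total variation on [a,b] (for s = 0: g of finite total variation on [a,b]), the affinely transformed formula Q_{[a,b]}[g] := (h/2) Σ_{j=1}^ℓ a_j g(a + (h/2)(x_j + 1)) satisfies |∫_a^b g(x) dx − Q_{[a,b]}[g]| ≤ C (h/2)^{s+1} · Var_{[a,b]} g^{(s)}. -/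

import Mathlib

open MeasureTheory Finset

/-- The total variation of `g` over the interval `[a, b]`. -/
noncomputable def totalVar (g : ℝ → ℝ) (a b : ℝ) : ℝ :=
  (eVariationOn g (Set.Icc a b)).toReal

/-- `g` is absolutely continuous on the interval `[a, b]`:  for every `ε > 0` there is
`δ > 0` such that for every finite collection of non-overlapping subintervals
`[c i, d i]` of `[a, b]` of total length `< δ`, the sum `∑ |g (d i) - g (c i)| < ε`. -/
def AbsContOn (g : ℝ → ℝ) (a b : ℝ) : Prop :=
  ∀ ε > 0, ∃ δ > 0, ∀ (k : ℕ) (c d : Fin k → ℝ),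
    (∀ i, c i ∈ Set.Icc a b ∧ d i ∈ Set.Icc a b ∧ c i ≤ d i) →
    (Pairwise fun i j => Disjoint (Set.Ioo (c i) (d i)) (Set.Ioo (c j) (d j))) →
    (∑ i, (d i - c i)) < δ → (∑ i, |g (d i) - g (c i)|) < ε

/-- Membership in the class `V s` over the interval `[a, b]`:  for `s = 0` it means that
`g` has bounded (total) variation on `[a, b]`; for `s ≥ 1` it means that the derivatives
of `g` up to order `s` exist on `[a, b]`, that `g^{(s-1)}` is absolutely continuous on
`[a, b]`, and that `g^{(s)}` has bounded variation on `[a, b]`. -/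
def MemV (s : ℕ) (g : ℝ → ℝ) (a b : ℝ) : Prop :=
  match s with
  | 0 => BoundedVariationOn g (Set.Icc a b)
  | t + 1 =>
      (∀ i ≤ t, DifferentiableOn ℝ (iteratedDerivWithin i g (Set.Icc a b)) (Set.Icc a b)) ∧
      AbsContOn (iteratedDerivWithin t g (Set.Icc a b)) a b ∧
      BoundedVariationOn (iteratedDerivWithin (t + 1) g (Set.Icc a b)) (Set.Icc a b)

/-- Every real polynomial has an antiderivative whose degree is at most one larger. -/
lemma Polynomial.exists_derivative_eq {n : ℕ} (q : Polynomial ℝ) (hq : q.natDegree ≤ n) :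
    ∃ p : Polynomial ℝ, p.natDegree ≤ n + 1 ∧ p.derivative = q := by
  refine ⟨∑ i ∈ Finset.range (n + 1), .C (q.coeff i / (i + 1)) * .X ^ (i + 1), ?_, ?_⟩
  · refine Polynomial.natDegree_sum_le_of_forall_le _ _ fun i hi => ?_
    exact (Polynomial.natDegree_C_mul_X_pow_le _ _).trans (Finset.mem_range.mp hi)
  · conv_rhs => rw [q.as_sum_range_C_mul_X_pow' (Nat.lt_succ_of_le hq)]
    rw [Polynomial.derivative_sum]
    refine Finset.sum_congr rfl fun i _ => ?_
    rw [Polynomial.derivative_C_mul_X_pow]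
    have : (i : ℝ) + 1 ≠ 0 := by positivity
    push_cast
    rw [div_mul_cancel₀ _ this]

/-- If the `s`-th derivative of `g` has bounded variation `V` on `[a, b]`, then each lower-order
derivative `g⁽ⁱ⁾` is within `(b - a) ^ (s - i) * V` of a polynomial of degree at most `s - i`. -/
lemma exists_polynomial_near_iteratedDerivWithin {a b : ℝ} (hab : a < b) {g : ℝ → ℝ} {s : ℕ}
    (hd : ∀ i < s, DifferentiableOn ℝ (iteratedDerivWithin i g (Set.Icc a b)) (Set.Icc a b))
    (hbv : BoundedVariationOn (iteratedDerivWithin s g (Set.Icc a b)) (Set.Icc a b))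
    (k : ℕ) : ∀ i, i + k = s → ∃ p : Polynomial ℝ, p.natDegree ≤ k ∧ ∀ x ∈ Set.Icc a b,
      |iteratedDerivWithin i g (Set.Icc a b) x - p.eval x| ≤
        (b - a) ^ k * totalVar (iteratedDerivWithin s g (Set.Icc a b)) a b := by
  have ha : a ∈ Set.Icc a b := Set.left_mem_Icc.mpr hab.le
  induction k with
  | zero =>
    rintro i rfl
    refine ⟨.C (iteratedDerivWithin i g (Set.Icc a b) a), by simp, fun x hx => ?_⟩
    simpa [Real.dist_eq, totalVar] using hbv.dist_le hx ha
  | succ k ih =>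
    intro i hi
    obtain ⟨q, hq, hqx⟩ := ih (i + 1) (by omega)
    obtain ⟨P, hP, rfl⟩ := q.exists_derivative_eq hq
    set G := iteratedDerivWithin i g (Set.Icc a b) with hG
    set V := totalVar (iteratedDerivWithin s g (Set.Icc a b)) a b
    have hV : 0 ≤ V := ENNReal.toReal_nonneg
    refine ⟨P + .C (G a - P.eval a), ?_, fun x hx => ?_⟩
    · rwa [Polynomial.natDegree_add_C]
    have hderiv : ∀ y ∈ Set.Icc a b, HasDerivWithinAt (fun y => G y - P.eval y)
        (iteratedDerivWithin (i + 1) g (Set.Icc a b) y - P.derivative.eval y)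
        (Set.Icc a b) y := fun y hy => by
      rw [iteratedDerivWithin_succ]
      exact ((hd i (by omega) y hy).hasDerivWithinAt).sub (P.hasDerivAt y).hasDerivWithinAt
    have hmvt := (convex_Icc a b).norm_image_sub_le_of_norm_hasDerivWithin_le hderiv hqx ha hx
    have hle : ‖x - a‖ ≤ b - a := by
      rw [Real.norm_eq_abs, abs_of_nonneg (by linarith [hx.1])]
      linarith [hx.2]
    calc |G x - (P + .C (G a - P.eval a)).eval x|
        = ‖(G x - P.eval x) - (G a - P.eval a)‖ := by
          rw [Real.norm_eq_abs, Polynomial.eval_add, Polynomial.eval_C]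
          ring_nf
      _ ≤ (b - a) ^ k * V * ‖x - a‖ := hmvt
      _ ≤ (b - a) ^ k * V * (b - a) := by
          have := sub_pos.mpr hab
          gcongr
      _ = (b - a) ^ (k + 1) * V := by ring

lemma BoundedVariationOn.intervalIntegrable {f : ℝ → ℝ} {a b : ℝ}
    (hf : BoundedVariationOn f (Set.uIcc a b)) : IntervalIntegrable f volume a b := by
  obtain ⟨p, q, hp, hq, rfl⟩ := hf.locallyBoundedVariationOn.exists_monotoneOn_sub_monotoneOn
  exact hp.intervalIntegrable.sub hq.intervalIntegrable

lemma MemV.boundedVariationOn {s : ℕ} {g : ℝ → ℝ} {a b : ℝ} (h : MemV s g a b) :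
    BoundedVariationOn (iteratedDerivWithin s g (Set.Icc a b)) (Set.Icc a b) := by
  cases s with
  | zero => simpa [MemV] using h
  | succ t => exact h.2.2

lemma MemV.differentiableOn {s : ℕ} {g : ℝ → ℝ} {a b : ℝ} (h : MemV s g a b) :
    ∀ i < s, DifferentiableOn ℝ (iteratedDerivWithin i g (Set.Icc a b)) (Set.Icc a b) := by
  cases s with
  | zero => simp
  | succ t => exact fun i hi => h.1 i (Nat.lt_succ_iff.mp hi)

lemma MemV.intervalIntegrable {s : ℕ} {g : ℝ → ℝ} {a b : ℝ} (hab : a ≤ b) (h : MemV s g a b) :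
    IntervalIntegrable g volume a b := by
  cases s with
  | zero =>
    refine BoundedVariationOn.intervalIntegrable ?_
    rw [Set.uIcc_of_le hab]
    exact h
  | succ t =>
    refine ContinuousOn.intervalIntegrable ?_
    rw [Set.uIcc_of_le hab]
    simpa using (h.differentiableOn 0 t.succ_pos).continuousOn

/-- Affine transforms of quadrature formulas have the same degree of exactness. -/
lemma integral_eval_eq_scaled_quadrature {l m : ℕ} {x A : Fin l → ℝ}
    (h_exact : ∀ p : Polynomial ℝ, p.degree ≤ (m : WithBot ℕ) →
      ∑ j, A j * p.eval (x j) = ∫ t in (-1 : ℝ)..1, p.eval t)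
    (p : Polynomial ℝ) (hp : p.natDegree ≤ m) (a b : ℝ) :
    ∫ t in a..b, p.eval t =
      ((b - a) / 2) * ∑ j, A j * p.eval (a + ((b - a) / 2) * (x j + 1)) := by
  set H := (b - a) / 2 with hH
  set L : Polynomial ℝ := .C H * .X + .C (a + H) with hL
  have hdeg : (p.comp L).natDegree ≤ m := by
    refine Polynomial.natDegree_comp_le.trans ((Nat.mul_le_mul_left _ ?_).trans
      ((mul_one _).trans_le hp))
    exact Polynomial.natDegree_linear_le
  have heval : ∀ t, (p.comp L).eval t = p.eval (H * t + (a + H)) := fun t => by simp [hL]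
  have hQ := h_exact (p.comp L) (Polynomial.natDegree_le_iff_degree_le.mp hdeg)
  simp only [heval] at hQ
  have hsub := intervalIntegral.smul_integral_comp_mul_add (a := -1) (b := 1)
    (fun t => p.eval t) H (a + H)
  rw [← hQ, show H * -1 + (a + H) = a by ring, show H * 1 + (a + H) = b by rw [hH]; ring,
    smul_eq_mul] at hsub
  rw [← hsub]
  congr 1
  refine Finset.sum_congr rfl fun j _ => ?_
  rw [show a + H * (x j + 1) = H * x j + (a + H) by ring]

/-- **Local (Peano-kernel) error bound for an affinely transformed quadrature formula.**
Let `Q[f] = ∑ j, A j * f (x j)` be a quadrature formula on `[-1, 1]` that is exact on all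
polynomials of degree at most `m`, and fix `s ∈ {0, …, m}`.  Then there is a constant `C`
depending only on `Q` and `s` such that for every interval `[a, b]` of length
`h = b - a > 0` and every `g` with `g^{(s-1)}` absolutely continuous and `g^{(s)}` of
bounded variation on `[a, b]` (for `s = 0`: `g` of bounded variation on `[a, b]`), the
transformed formula `Q_{[a,b]}[g] = (h/2) ∑ j, A j * g (a + (h/2)(x j + 1))` satisfies
`|∫_a^b g - Q_{[a,b]}[g]| ≤ C (h/2)^(s+1) · Var_{[a,b]} g⁽ˢ⁾`. -/
theorem scaled_quadrature_error_bound
    (l : ℕ) (x A : Fin l → ℝ)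
    (hx_mono : StrictMono x) (hx_mem : ∀ j, x j ∈ Set.Icc (-1 : ℝ) 1)
    (m : ℕ)
    (h_exact : ∀ p : Polynomial ℝ, p.degree ≤ (m : WithBot ℕ) →
      ∑ j, A j * p.eval (x j) = ∫ t in (-1 : ℝ)..1, p.eval t)
    (s : ℕ) (hs : s ≤ m) :
    ∃ C : ℝ, ∀ a b : ℝ, a < b → ∀ g : ℝ → ℝ, MemV s g a b →
      |(∫ t in a..b, g t) -
          ((b - a) / 2) * ∑ j, A j * g (a + ((b - a) / 2) * (x j + 1))| ≤
        C * ((b - a) / 2) ^ (s + 1) *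
          totalVar (iteratedDerivWithin s g (Set.Icc a b)) a b := by
  refine ⟨2 ^ s * (2 + ∑ j, |A j|), fun a b hab g hg => ?_⟩
  obtain ⟨p, hp, hpx⟩ := exists_polynomial_near_iteratedDerivWithin hab hg.differentiableOn
    hg.boundedVariationOn s 0 (zero_add s)
  simp only [iteratedDerivWithin_zero] at hpx
  set V := totalVar (iteratedDerivWithin s g (Set.Icc a b)) a b
  set H := (b - a) / 2 with hH
  have hH0 : 0 < H := by rw [hH]; linarith
  have hba : b - a = 2 * H := by rw [hH]; ring
  set K := (b - a) ^ s * V with hK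
  have hint : |(∫ t in a..b, g t) - ∫ t in a..b, p.eval t| ≤ K * (b - a) := by
    rw [← intervalIntegral.integral_sub (hg.intervalIntegrable hab.le)
      (p.continuous.intervalIntegrable a b), ← abs_of_pos (sub_pos.mpr hab)]
    refine intervalIntegral.norm_integral_le_of_norm_le_const
      (f := fun t => g t - p.eval t) fun t ht => ?_
    rw [Set.uIoc_of_le hab.le] at ht
    exact hpx t (Set.Ioc_subset_Icc_self ht)
  have hsum : |∑ j, A j * p.eval (a + H * (x j + 1)) - ∑ j, A j * g (a + H * (x j + 1))| ≤
      (∑ j, |A j|) * K := by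
    rw [← Finset.sum_sub_distrib, Finset.sum_mul]
    refine (Finset.abs_sum_le_sum_abs _ _).trans (Finset.sum_le_sum fun j _ => ?_)
    rw [← mul_sub, abs_mul, abs_sub_comm]
    refine mul_le_mul_of_nonneg_left (hpx _ ⟨?_, ?_⟩) (abs_nonneg _)
    · nlinarith [(hx_mem j).1]
    · nlinarith [(hx_mem j).2]
  have hexact := integral_eval_eq_scaled_quadrature h_exact p (hp.trans hs) a b
  rw [← hH] at hexact
  calc |(∫ t in a..b, g t) - H * ∑ j, A j * g (a + H * (x j + 1))|
      = |((∫ t in a..b, g t) - ∫ t in a..b, p.eval t) + H *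
          (∑ j, A j * p.eval (a + H * (x j + 1)) - ∑ j, A j * g (a + H * (x j + 1)))| := by
        rw [hexact]
        ring_nf
    _ ≤ K * (b - a) + H * ((∑ j, |A j|) * K) := by
        refine (abs_add_le _ _).trans (add_le_add hint ?_)
        rw [abs_mul, abs_of_pos hH0]
        exact mul_le_mul_of_nonneg_left hsum hH0.le
    _ = 2 ^ s * (2 + ∑ j, |A j|) * H ^ (s + 1) * V := by
        rw [hK, hba, mul_pow, pow_succ]
        ring
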